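/- arXiv:1802.10180 — 8 statements merged into one kernel-verified Lean document; each statement's English description precedes it below -/
import Mathlib

section
/- Let k ≥ 2 and let w : ℕ → Fin k be a sequence such that for every i ∈ ℕ, A(w(i), w(i+1)) holds, where A is the adjacency relation of P_k^{**}, and such that for every i ∈ ℕ, w(i+2) ≠ w(i) (i.e., the walk never uses the same edge twice in a row). Then for every i ∈ ℕ, w(i + 2k) = w(i); in particular w(2k) = w(0). -/
/-- Adjacency relation of the role graph `P_k^{**}`: the path on `Fin k`
with loops at both ends. -/
def pathStarStarAdj (k : ℕ) (i j : Fin k) : Prop :=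
  (i.val + 1 = j.val ∨ j.val + 1 = i.val) ∨ (i = j ∧ (i.val = 0 ∨ i.val = k - 1))

/-- The `2k`-periodic sequence `0, 1, …, k - 1, k - 1, …, 1, 0, 0, 1, …`. -/
def cyclicFold (k p : ℕ) : ℕ :=
  if p % (2 * k) < k then p % (2 * k) else 2 * k - 1 - p % (2 * k)

theorem cyclicFold_add_period (k p : ℕ) : cyclicFold k (p + 2 * k) = cyclicFold k p := by
  simp [cyclicFold]

theorem Nat.add_one_mod_eq_ite {m : ℕ} (hm : 0 < m) (p : ℕ) :
    (p + 1) % m = if p % m + 1 = m then 0 else p % m + 1 := by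
  have hlt := Nat.mod_lt p hm
  rw [← Nat.mod_add_mod]
  split_ifs with h
  · rw [h, Nat.mod_self]
  · exact Nat.mod_eq_of_lt (by omega)

/-- Every edge of `P_k^{**}` is traversed by `cyclicFold k` in the given direction. -/
theorem exists_cyclicFold_eq_of_adj {k : ℕ} {a b : Fin k} (h : pathStarStarAdj k a b) :
    ∃ c, cyclicFold k c = a.val ∧ cyclicFold k (c + 1) = b.val := by
  have ha := a.isLt
  have hb := b.isLt
  have key : ∃ c < 2 * k, (if c < k then c else 2 * k - 1 - c) = a.val ∧
      (if c + 1 = 2 * k then 0 else if c + 1 < k then c + 1 else 2 * k - 1 - (c + 1)) = b.val := by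
    rcases h with (h | h) | ⟨rfl, h | h⟩
    · exact ⟨a, by omega, by split_ifs; omega, by split_ifs <;> omega⟩
    · exact ⟨2 * k - 1 - a, by omega, by split_ifs <;> omega, by split_ifs <;> omega⟩
    · exact ⟨2 * k - 1, by omega, by split_ifs <;> omega, by split_ifs <;> omega⟩
    · exact ⟨k - 1, by omega, by split_ifs <;> omega, by split_ifs <;> omega⟩
  obtain ⟨c, hc, h₁, h₂⟩ := key
  refine ⟨c, ?_, ?_⟩
  · rwa [cyclicFold, Nat.mod_eq_of_lt hc]
  · rw [cyclicFold, Nat.add_one_mod_eq_ite (by omega), Nat.mod_eq_of_lt hc, ← h₂]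
    split_ifs <;> omega

/-- A step in `P_k^{**}` that does not reuse the previous edge follows `cyclicFold k`. -/
theorem cyclicFold_add_two_eq {k p : ℕ} {a b c : Fin k} (hbc : pathStarStarAdj k b c)
    (hca : c ≠ a) (ha : cyclicFold k p = a.val) (hb : cyclicFold k (p + 1) = b.val) :
    cyclicFold k (p + 2) = c.val := by
  have hclt := c.isLt
  have hpos : 0 < 2 * k := by omega
  have hlt := Nat.mod_lt p hpos
  rw [Ne, Fin.ext_iff] at hca
  simp only [pathStarStarAdj, Fin.ext_iff] at hbc
  simp only [cyclicFold, Nat.add_one_mod_eq_ite hpos (p + 1), Nat.add_one_mod_eq_ite hpos p]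
    at ha hb ⊢
  generalize p % (2 * k) = r at *
  split_ifs at * <;> omega

/-- A walk in `P_k^{**}` that never uses the same edge twice in a row is
periodic with period `2k`. -/
theorem walk_in_pathStarStar_periodic (k : ℕ) (hk : 2 ≤ k) (w : ℕ → Fin k)
    (hadj : ∀ i : ℕ, pathStarStarAdj k (w i) (w (i + 1)))
    (hnorep : ∀ i : ℕ, w (i + 2) ≠ w i) :
    (∀ i : ℕ, w (i + 2 * k) = w i) ∧ w (2 * k) = w 0 := by
  obtain ⟨c, h₀, h₁⟩ := exists_cyclicFold_eq_of_adj (hadj 0)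
  have hfold : ∀ n, cyclicFold k (c + n) = (w n).val ∧
      cyclicFold k (c + n + 1) = (w (n + 1)).val := by
    intro n
    induction n with
    | zero => exact ⟨h₀, h₁⟩
    | succ n ih =>
      exact ⟨ih.2, cyclicFold_add_two_eq (hadj (n + 1)) (hnorep n) ih.1 ih.2⟩
  have hper : ∀ i, w (i + 2 * k) = w i := fun i => by
    rw [Fin.ext_iff, ← (hfold _).1, ← (hfold _).1, ← Nat.add_assoc, cyclicFold_add_period]
  exact ⟨hper, by simpa using hper 0⟩
end

section
/- Let k ≥ 3, let G be a simple graph on a finite vertex set, and let r be a C_k-role colouring of G. Suppose u_0, u_1, …, u_k are pairwise distinct vertices of G such that u_{i−1} is adjacent to u_i for every 1 ≤ i ≤ k, and such that deg_G(u_i) = 2 for every 1 ≤ i ≤ k−1. Then r(u_0) = r(u_k). -/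
/-- Adjacency relation of the role graph `C_k`: the cycle on `Fin k`,
`i` adjacent to `j` iff `i - j ≡ 1 (mod k)` or `j - i ≡ 1 (mod k)`. -/
def cycleAdj (k : ℕ) (i j : Fin k) : Prop :=
  (j.val + 1) % k = i.val ∨ (i.val + 1) % k = j.val

/-- An `A`-role colouring of `G`: the image of every open neighbourhood
equals the `A`-neighbourhood of the vertex's colour. -/
def IsRoleColoring {V : Type*} {k : ℕ} (G : SimpleGraph V)
    (A : Fin k → Fin k → Prop) (r : V → Fin k) : Prop :=
  ∀ v : V, r '' (G.neighborSet v) = {j : Fin k | A (r v) j}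

/-- If the `C_k`-neighbourhood of `z` consists of `a` and `b`, then `z` is the midpoint of
`a` and `b` modulo `k`. -/
theorem cycleAdj_add_eq_two_mul {k : ℕ} (hk : 3 ≤ k) {a b z : Fin k}
    (h : ∀ j, cycleAdj k z j → j = a ∨ j = b) :
    ((a.val : ZMod k) + (b.val : ZMod k)) = 2 * (z.val : ZMod k) := by
  have hz := z.isLt
  have hsucc := h ⟨(z.val + 1) % k, Nat.mod_lt _ (by omega)⟩ (Or.inr rfl)
  have hpred := h ⟨(z.val + (k - 1)) % k, Nat.mod_lt _ (by omega)⟩ (Or.inl (by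
    rw [Nat.mod_add_mod, show z.val + (k - 1) + 1 = z.val + k by omega, Nat.add_mod_right,
      Nat.mod_eq_of_lt hz]))
  have hne : (z.val + 1) % k ≠ (z.val + (k - 1)) % k := by
    intro he
    have h1 : 1 % k = (k - 1) % k := Nat.ModEq.add_left_cancel' z.val he
    rw [Nat.mod_eq_of_lt (by omega), Nat.mod_eq_of_lt (by omega)] at h1
    omega
  have hsum : (((z.val + 1) % k : ℕ) : ZMod k) + (((z.val + (k - 1)) % k : ℕ) : ZMod k)
      = 2 * (z.val : ZMod k) := by
    rw [ZMod.natCast_mod, ZMod.natCast_mod, ← Nat.cast_add,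
      show z.val + 1 + (z.val + (k - 1)) = 2 * z.val + k by omega]
    simp
  simp only [Fin.ext_iff] at hsucc hpred
  rcases hsucc with h1 | h1 <;> rcases hpred with h2 | h2
  · exact absurd (h1.trans h2.symm) hne
  · rwa [h1, h2] at hsum
  · rwa [h1, h2, add_comm] at hsum
  · exact absurd (h1.trans h2.symm) hne

/-- A vertex of degree two has no neighbours besides any two given distinct ones. -/
theorem SimpleGraph.eq_or_eq_of_degree_eq_two {V : Type*} [Fintype V] (G : SimpleGraph V)
    [DecidableRel G.Adj] {v a b w : V} (hv : G.degree v = 2) (ha : G.Adj v a) (hb : G.Adj v b)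
    (hab : a ≠ b) (hw : G.Adj v w) : w = a ∨ w = b := by
  classical
  have hsub : ({a, b} : Finset V) ⊆ G.neighborFinset v := by
    simp [Finset.insert_subset_iff, ha, hb]
  have heq := Finset.eq_of_subset_of_card_le hsub (by
    rw [G.card_neighborFinset_eq_degree, hv, Finset.card_pair hab])
  have hmem : w ∈ ({a, b} : Finset V) := by
    rw [heq]
    simpa using hw
  simpa using hmem

theorem cycle_role_coloring_period {V : Type*} [Fintype V]
    (G : SimpleGraph V) [DecidableRel G.Adj]
    (k : ℕ) (hk : 3 ≤ k) (r : V → Fin k)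
    (hr : IsRoleColoring G (cycleAdj k) r)
    (u : ℕ → V)
    (hinj : ∀ i j : ℕ, i ≤ k → j ≤ k → u i = u j → i = j)
    (hadj : ∀ i : ℕ, 1 ≤ i → i ≤ k → G.Adj (u (i - 1)) (u i))
    (hdeg : ∀ i : ℕ, 1 ≤ i → i ≤ k - 1 → G.degree (u i) = 2) :
    r (u 0) = r (u k) := by
  set c : ℕ → ZMod k := fun i => ((r (u i)).val : ZMod k)
  have hstep : ∀ i, i + 2 ≤ k → c i + c (i + 2) = 2 * c (i + 1) := by
    intro i hi
    refine cycleAdj_add_eq_two_mul hk fun j hj => ?_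
    have hmem : j ∈ r '' G.neighborSet (u (i + 1)) := by
      rw [hr]
      exact hj
    obtain ⟨w, hw, rfl⟩ := hmem
    have hw' := G.eq_or_eq_of_degree_eq_two (hdeg (i + 1) (by omega) (by omega))
      (hadj (i + 1) (by omega) (by omega)).symm (hadj (i + 2) (by omega) hi)
      (fun h => by have := hinj _ _ (by omega) hi h; omega) hw
    exact hw'.imp (congrArg r) (congrArg r)
  have hprog : ∀ i, i + 1 ≤ k →
      c i = c 0 + i * (c 1 - c 0) ∧ c (i + 1) = c 0 + (i + 1) * (c 1 - c 0) := by
    intro i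
    induction i with
    | zero => intro _; simp
    | succ n ih =>
      intro hn
      obtain ⟨h1, h2⟩ := ih (by omega)
      refine ⟨by push_cast; exact h2, ?_⟩
      push_cast
      linear_combination hstep n hn - h1 + 2 * h2
  obtain ⟨m, rfl⟩ : ∃ m, k = m + 1 := ⟨k - 1, by omega⟩
  have hend := (hprog m le_rfl).2
  have hzero : ((m : ZMod (m + 1)) + 1) = 0 := by
    exact_mod_cast ZMod.natCast_self (m + 1)
  rw [hzero, zero_mul, add_zero] at hend
  have hmod := (ZMod.natCast_eq_natCast_iff' _ _ _).1 hend
  rw [Nat.mod_eq_of_lt (r _).isLt, Nat.mod_eq_of_lt (r _).isLt] at hmod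
  exact Fin.ext hmod.symm
end

section
/- Let k ≥ 2, let G be a simple graph on a finite vertex set, and let r be a P_k-role colouring of G. Suppose u_0, u_1, …, u_{2k−2} are pairwise distinct vertices of G such that u_{i−1} is adjacent to u_i for every 1 ≤ i ≤ 2k−2, and such that deg_G(u_i) = 2 for every 1 ≤ i ≤ 2k−3. Then r(u_0) = r(u_{2k−2}). -/
/-- Adjacency relation of the role graph `P_k`: the path on `Fin k`,
`i` adjacent to `j` iff `|i - j| = 1`. -/
def pathAdj (k : ℕ) (i j : Fin k) : Prop :=
  i.val + 1 = j.val ∨ j.val + 1 = i.val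

/-- A unit-step sequence in `{0, …, n}` that starts upwards and only turns at the two ends
has period `2 * n`. -/
theorem reflecting_sequence_period_of_up {n : ℕ} {c : ℕ → ℕ}
    (hle : ∀ i ≤ 2 * n, c i ≤ n)
    (hstep : ∀ i < 2 * n, c (i + 1) = c i + 1 ∨ c i = c (i + 1) + 1)
    (hturn : ∀ i, i + 1 < 2 * n → 0 < c (i + 1) → c (i + 1) < n → c i ≠ c (i + 2))
    (hn : 0 < n) (hup : c 1 = c 0 + 1) : c 0 = c (2 * n) := by
  let IsReflected (i : ℕ) : Prop :=
    (c 0 + i ≤ n ∧ c i = c 0 + i) ∨ (n ≤ c 0 + i ∧ c 0 + i ≤ 2 * n ∧ c i + c 0 + i = 2 * n) ∨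
      (2 * n ≤ c 0 + i ∧ c i + 2 * n = c 0 + i)
  have h₁ := hle 1 (by omega)
  have key : ∀ i, i + 1 ≤ 2 * n → IsReflected i ∧ IsReflected (i + 1) := by
    intro i
    induction i with
    | zero => intro _; simp only [IsReflected, zero_add]; omega
    | succ i ih =>
      intro hi
      obtain ⟨h, h'⟩ := ih (by omega)
      refine ⟨h', ?_⟩
      have hs := hstep i (by omega)
      have hs' := hstep (i + 1) hi
      have ht := hturn i hi
      have hl := hle (i + 2) hi
      simp only [IsReflected, add_assoc, Nat.reduceAdd] at *
      omega
  have h := (key (2 * n - 1) (by omega)).2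
  rw [show 2 * n - 1 + 1 = 2 * n by omega] at h
  simp only [IsReflected] at h
  omega

/-- A unit-step sequence in `{0, …, n}` that only turns at the two ends has period `2 * n`. -/
theorem reflecting_sequence_period {n : ℕ} {c : ℕ → ℕ}
    (hle : ∀ i ≤ 2 * n, c i ≤ n)
    (hstep : ∀ i < 2 * n, c (i + 1) = c i + 1 ∨ c i = c (i + 1) + 1)
    (hturn : ∀ i, i + 1 < 2 * n → 0 < c (i + 1) → c (i + 1) < n → c i ≠ c (i + 2))
    (hn : 0 < n) : c 0 = c (2 * n) := by
  rcases hstep 0 (by omega) with hup | hdown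
  · exact reflecting_sequence_period_of_up hle hstep hturn hn hup
  · have h₀ := hle 0 (by omega)
    have h₂ := hle (2 * n) le_rfl
    have h := reflecting_sequence_period_of_up (n := n) (c := fun i => n - c i)
      (fun i _ => Nat.sub_le _ _)
      (fun i hi => by
        have := hstep i hi
        have := hle i hi.le
        have := hle (i + 1) hi
        omega)
      (fun i hi hpos hlt => by
        have := hturn i hi (by omega) (by omega)
        have := hle i (by omega)
        have := hle (i + 2) hi
        omega)
      hn (by simp only [zero_add] at hdown; omega)
    omega

/-- In a `P_k`-role colouring, the two neighbours of a vertex of degree two whose colour is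
internal to the path have different colours. -/
theorem IsRoleColoring.ne_of_degree_eq_two {V : Type*} {G : SimpleGraph V} {k : ℕ}
    {r : V → Fin k} (hr : IsRoleColoring G (pathAdj k) r) {v a b : V}
    [Fintype (G.neighborSet v)] (hdeg : G.degree v = 2) (ha : G.Adj v a) (hb : G.Adj v b)
    (hab : a ≠ b) (hpos : 0 < (r v).val) (hlt : (r v).val + 1 < k) : r a ≠ r b := by
  classical
  intro heq
  have hN : ({a, b} : Finset V) = G.neighborFinset v := by
    apply Finset.eq_of_subset_of_card_le
    · simp [Finset.insert_subset_iff, ha, hb]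
    · rw [G.card_neighborFinset_eq_degree, hdeg, Finset.card_pair hab]
  have hall : ∀ j : Fin k, pathAdj k (r v) j → j = r a := by
    intro j hj
    have hmem : j ∈ r '' G.neighborSet v := by rw [hr v]; exact hj
    obtain ⟨w, hw, rfl⟩ := hmem
    have hw' : w ∈ ({a, b} : Finset V) := by
      rw [hN]; exact (G.mem_neighborFinset v w).2 hw
    rcases (by simpa using hw' : w = a ∨ w = b) with rfl | rfl
    · rfl
    · exact heq.symm
  have h₁ := hall ⟨(r v).val + 1, hlt⟩ (Or.inl rfl)
  have h₂ := hall ⟨(r v).val - 1, by omega⟩ (Or.inr (Nat.sub_add_cancel hpos))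
  have h : (r v).val + 1 = (r v).val - 1 := congrArg Fin.val (h₁.trans h₂.symm)
  omega

theorem path_role_coloring_period {V : Type*} [Fintype V]
    (G : SimpleGraph V) [DecidableRel G.Adj]
    (k : ℕ) (hk : 2 ≤ k) (r : V → Fin k)
    (hr : IsRoleColoring G (pathAdj k) r)
    (u : ℕ → V)
    (hinj : ∀ i j : ℕ, i ≤ 2 * k - 2 → j ≤ 2 * k - 2 → u i = u j → i = j)
    (hadj : ∀ i : ℕ, 1 ≤ i → i ≤ 2 * k - 2 → G.Adj (u (i - 1)) (u i))
    (hdeg : ∀ i : ℕ, 1 ≤ i → i ≤ 2 * k - 3 → G.degree (u i) = 2) :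
    r (u 0) = r (u (2 * k - 2)) := by
  have hadj' : ∀ i < 2 * (k - 1), G.Adj (u i) (u (i + 1)) := fun i hi => by
    simpa using hadj (i + 1) (by omega) (by omega)
  have h := reflecting_sequence_period (n := k - 1) (c := fun i => (r (u i)).val)
    (fun i _ => Nat.le_sub_one_of_lt (r (u i)).isLt)
    (fun i hi => by
      have hmem : r (u (i + 1)) ∈ r '' G.neighborSet (u i) := ⟨_, hadj' i hi, rfl⟩
      rw [hr (u i)] at hmem
      exact hmem.imp Eq.symm Eq.symm)
    (fun i hi hpos hlt heq =>
      hr.ne_of_degree_eq_two (hdeg (i + 1) (by omega) (by omega)) (hadj' i (by omega)).symm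
        (hadj' (i + 1) hi)
        (fun hu => by have := hinj i (i + 2) (by omega) (by omega) hu; omega)
        hpos (by omega) (Fin.ext heq))
    (by omega)
  rw [show 2 * k - 2 = 2 * (k - 1) by omega]
  exact Fin.ext h
end

section
/- Let k ≥ 2, let G be a simple graph on a finite vertex set, and suppose G contains an ear of length 2k, i.e., pairwise distinct vertices v_1, …, v_{2k}, each of degree 2 in G, such that v_i is adjacent to v_{i+1} for 1 ≤ i ≤ 2k−1 and no other pairs among v_1, …, v_{2k} are adjacent (they induce a path). Let A be a symmetric relation on Fin k such that any two colours are joined by a finite chain of A-related colours (the role graph is connected), and suppose G admits an A-role colouring that is surjective onto Fin k. Then every colour has degree at most 2 in the role graph: for every c ∈ Fin k, the cardinality of {j : Fin k | A c j} is at most 2. -/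
/-- A vertex coloured `a` by a role colouring sees at least as many vertices as `a` sees colours. -/
theorem IsRoleColoring.ncard_le_degree {V : Type*} [Fintype V] {k : ℕ} {G : SimpleGraph V}
    [DecidableRel G.Adj] {A : Fin k → Fin k → Prop} {r : V → Fin k} (hr : IsRoleColoring G A r)
    (u : V) : ({j : Fin k | A (r u) j} : Set (Fin k)).ncard ≤ G.degree u := by
  rw [← hr u, ← G.card_neighborFinset_eq_degree u, ← Set.ncard_coe_finset,
    SimpleGraph.coe_neighborFinset]
  exact Set.ncard_image_le (Set.toFinite _)

/-- The neighbourhood of a vertex of degree 2 consists of any two distinct neighbours. -/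
theorem SimpleGraph.neighborSet_eq_pair_of_degree_eq_two {V : Type*} [Fintype V]
    {G : SimpleGraph V} [DecidableRel G.Adj] {u x y : V} (hu : G.degree u = 2)
    (hx : G.Adj u x) (hy : G.Adj u y) (hxy : x ≠ y) : G.neighborSet u = {x, y} := by
  symm
  refine Set.eq_of_subset_of_ncard_le ?_ ?_ (Set.toFinite _)
  · rintro z (rfl | rfl) <;> assumption
  · rw [Set.ncard_pair hxy, ← SimpleGraph.coe_neighborFinset, Set.ncard_coe_finset,
      G.card_neighborFinset_eq_degree, hu]

/-- Unordered pairs sharing one entry share the other. -/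
theorem eq_of_pair_eq {α : Type*} {a b b' : α} (h : ∀ x, x = a ∨ x = b ↔ x = a ∨ x = b') :
    b = b' := by
  rcases (h b).1 (Or.inr rfl) with rfl | hb
  · exact ((h b').2 (Or.inr rfl)).elim Eq.symm Eq.symm
  · exact hb

/-- If two consecutive pairs of a sequence coincide, and the neighbours of every interior term
are exactly its predecessor and successor, then the coincidence propagates forwards. -/
theorem eq_add_of_nbrs {α : Type*} {A : α → α → Prop} {c : ℕ → α} {m i j : ℕ}
    (hnbr : ∀ i, i + 2 < m → ∀ x, A (c (i + 1)) x ↔ x = c i ∨ x = c (i + 2))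
    (h0 : c i = c j) (h1 : c (i + 1) = c (j + 1)) (t : ℕ) (hi : i + t + 1 < m)
    (hj : j + t + 1 < m) : c (i + t) = c (j + t) ∧ c (i + t + 1) = c (j + t + 1) := by
  induction t with
  | zero => exact ⟨h0, h1⟩
  | succ t ih =>
    obtain ⟨e0, e1⟩ := ih (by omega) (by omega)
    have hi' := hnbr (i + t) (by omega)
    have hj' := hnbr (j + t) (by omega)
    rw [e1] at hi'
    refine ⟨e1, ?_⟩
    rw [e0] at hi'
    exact eq_of_pair_eq fun x => (hi' x).symm.trans (hj' x)

/-- The backwards analogue of `eq_add_of_nbrs`. -/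
theorem eq_zero_of_nbrs {α : Type*} {A : α → α → Prop} {c : ℕ → α} {m p : ℕ}
    (hnbr : ∀ i, i + 2 < m → ∀ x, A (c (i + 1)) x ↔ x = c i ∨ x = c (i + 2)) (i : ℕ)
    (h0 : c i = c (i + p)) (h1 : c (i + 1) = c (i + p + 1)) (hi : i + p + 1 < m) :
    c 0 = c p ∧ c 1 = c (p + 1) := by
  induction i with
  | zero => simpa using And.intro h0 h1
  | succ i ih =>
    rw [show i + 1 + p = i + p + 1 by omega] at h0 h1
    have hi' := hnbr i (by omega)
    have hj' := hnbr (i + p) (by omega)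
    rw [h0] at hi'
    refine ih ?_ h0 (by omega)
    change c (i + 2) = c (i + p + 2) at h1
    rw [h1] at hi'
    exact eq_of_pair_eq fun x => by rw [or_comm, ← hi' x, hj' x, or_comm]

/-- A walk with `2 * n` terms taking fewer than `n` values, each with at most two neighbours,
traverses some arc twice. -/
theorem exists_repeated_arc {α : Type*} [Fintype α] {A : α → α → Prop} {c : ℕ → α} {n : ℕ}
    (hadj : ∀ i, i + 1 < 2 * n → A (c i) (c (i + 1)))
    (S : Finset α) (hS : ∀ i < 2 * n, c i ∈ S) (hcard : S.card < n)
    (hdeg : ∀ a ∈ S, {x | A a x}.ncard ≤ 2) :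
    ∃ i j, i < j ∧ j + 1 < 2 * n ∧ c i = c j ∧ c (i + 1) = c (j + 1) := by
  classical
  let T : Finset (Σ _ : α, α) := S.sigma fun a => Finset.univ.filter (A a)
  have hT : T.card < (Finset.range (2 * n - 1)).card := by
    have : T.card ≤ ∑ _a ∈ S, 2 := by
      rw [Finset.card_sigma]
      refine Finset.sum_le_sum fun a ha => ?_
      rw [← Set.ncard_coe_finset]
      simpa using hdeg a ha
    simp only [Finset.sum_const, smul_eq_mul] at this
    rw [Finset.card_range]
    omega
  obtain ⟨i, hi, j, hj, hij, he⟩ := Finset.exists_ne_map_eq_of_card_lt_of_maps_to hT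
    (f := fun i => (⟨c i, c (i + 1)⟩ : Σ _ : α, α)) (by
      intro i hi
      have hi : i < 2 * n - 1 := by simpa using hi
      simpa [T] using And.intro (hS i (by omega)) (hadj i (by omega)))
  simp only [Finset.mem_range] at hi hj
  have h0 : c i = c j := congrArg Sigma.fst he
  have h1 : c (i + 1) = c (j + 1) := congrArg (fun p : Σ _ : α, α => p.2) he
  rcases lt_or_gt_of_ne hij with h | h
  · exact ⟨i, j, h, by omega, h0, h1⟩
  · exact ⟨j, i, h, by omega, h0.symm, h1.symm⟩

/-- A sequence which traverses some arc twice, and in which the neighbours of every interior term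
are exactly its predecessor and successor, takes all its values at interior terms. -/
theorem exists_interior_eq {α : Type*} {A : α → α → Prop} {c : ℕ → α} {m i j : ℕ}
    (hnbr : ∀ i, i + 2 < m → ∀ x, A (c (i + 1)) x ↔ x = c i ∨ x = c (i + 2))
    (hij : i < j) (hj : j + 1 < m) (h0 : c i = c j) (h1 : c (i + 1) = c (j + 1))
    (l : ℕ) (hl : l < m) : ∃ q, q + 2 < m ∧ c l = c (q + 1) := by
  obtain ⟨p, rfl⟩ := Nat.exists_eq_add_of_lt hij
  obtain ⟨z0, z1⟩ := eq_zero_of_nbrs (p := p + 1) hnbr i h0 h1 hj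
  rcases Nat.eq_zero_or_pos l with rfl | hpos
  · exact ⟨p, by omega, z0⟩
  rcases lt_or_ge (l + 1) m with hlm | hlm
  · exact ⟨l - 1, by omega, by rw [Nat.sub_add_cancel hpos]⟩
  · have e := (eq_add_of_nbrs (i := 0) (j := p + 1) hnbr z0 (by simpa using z1)
      (m - p - 3) (by omega) (by omega)).2
    refine ⟨m - p - 3, by omega, ?_⟩
    rw [show l = p + 1 + (m - p - 3) + 1 by omega, ← e, Nat.zero_add]

/-- If `G` has an ear of length `2k` (an induced path on `2k` vertices, all of
degree 2 in `G`), and `G` admits a surjective `A`-role colouring with `k`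
colours whose role graph is connected, then every colour has degree at most 2
in the role graph. -/
theorem ear_role_graph_max_degree_two {V : Type*} [Fintype V]
    (G : SimpleGraph V) [DecidableRel G.Adj]
    (k : ℕ) (hk : 2 ≤ k)
    (v : ℕ → V)
    (hinj : ∀ i j : ℕ, i < 2 * k → j < 2 * k → v i = v j → i = j)
    (hdeg : ∀ i : ℕ, i < 2 * k → G.degree (v i) = 2)
    (hpath : ∀ i j : ℕ, i < 2 * k → j < 2 * k →
      (G.Adj (v i) (v j) ↔ (i + 1 = j ∨ j + 1 = i)))
    (A : Fin k → Fin k → Prop) (hA : Symmetric A)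
    (hconn : ∀ a b : Fin k, Relation.ReflTransGen A a b)
    (hcol : ∃ r : V → Fin k, IsRoleColoring G A r ∧ Function.Surjective r) :
    ∀ c : Fin k, ({j : Fin k | A c j} : Set (Fin k)).ncard ≤ 2 := by
  obtain ⟨r, hr, -⟩ := hcol
  intro d
  by_contra hd
  let c : ℕ → Fin k := fun i => r (v i)
  have hcdeg (i : ℕ) (hi : i < 2 * k) : {j | A (c i) j}.ncard ≤ 2 :=
    (hr.ncard_le_degree (v i)).trans (hdeg i hi).le
  have hnbr (i : ℕ) (hi : i + 2 < 2 * k) (x : Fin k) :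
      A (c (i + 1)) x ↔ x = c i ∨ x = c (i + 2) := by
    have hN : G.neighborSet (v (i + 1)) = {v i, v (i + 2)} := by
      apply SimpleGraph.neighborSet_eq_pair_of_degree_eq_two (hdeg _ (by omega))
      · exact (hpath _ _ (by omega) (by omega)).2 (Or.inr rfl)
      · exact (hpath _ _ (by omega) (by omega)).2 (Or.inl rfl)
      · intro h
        have := hinj i (i + 2) (by omega) hi h
        omega
    have h := Set.ext_iff.1 (hr (v (i + 1))) x
    rw [hN, Set.image_pair] at h
    exact h.symm
  have hadj (i : ℕ) (hi : i + 1 < 2 * k) : A (c i) (c (i + 1)) :=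
    (Set.ext_iff.1 (hr (v i)) _).1
      ⟨v (i + 1), (hpath _ _ (by omega) hi).2 (Or.inl rfl), rfl⟩
  let S : Finset (Fin k) := (Finset.range (2 * k)).image c
  have hmem {a : Fin k} : a ∈ S ↔ ∃ i < 2 * k, c i = a := by simp [S]
  have hdS : d ∉ S := by
    rw [hmem]
    rintro ⟨i, hi, rfl⟩
    exact hd (hcdeg i hi)
  have hcard : S.card < k := by
    simpa using Finset.card_lt_univ_of_notMem hdS
  obtain ⟨i, j, hij, hj, h0, h1⟩ := exists_repeated_arc hadj S
    (fun i hi => hmem.2 ⟨i, hi, rfl⟩) hcard (fun a ha => by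
      obtain ⟨i, hi, rfl⟩ := hmem.1 ha
      exact hcdeg i hi)
  have hclosed (a b : Fin k) (ha : a ∈ S) (hab : A a b) : b ∈ S := by
    obtain ⟨l, hl, rfl⟩ := hmem.1 ha
    obtain ⟨q, hq, e⟩ := exists_interior_eq hnbr hij hj h0 h1 l hl
    rw [e] at hab
    rcases (hnbr q hq b).1 hab with rfl | rfl
    · exact hmem.2 ⟨q, by omega, rfl⟩
    · exact hmem.2 ⟨q + 2, hq, rfl⟩
  have hall (b : Fin k) (h : Relation.ReflTransGen A (c 0) b) : b ∈ S := by
    induction h with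
    | refl => exact hmem.2 ⟨0, by omega, rfl⟩
    | tail _ h ih => exact hclosed _ _ ih h
  exact hdS (hall d (hconn _ _))
end

section
/- Let k ≥ 2 and let G be a simple graph on a finite vertex set containing a dangling induced cycle of length 2k−1: pairwise distinct vertices v_1, …, v_{2k−1} such that v_i is adjacent to v_{i+1} for 1 ≤ i ≤ 2k−2, v_{2k−1} is adjacent to v_1, no other pairs among v_1, …, v_{2k−1} are adjacent, deg_G(v_i) = 2 for every 2 ≤ i ≤ 2k−1, and deg_G(v_1) = 3. Then G admits no P_k-role colouring, and if k ≥ 3, G admits no C_k-role colouring. -/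
theorem IsRoleColoring.rel_of_adj {V : Type*} {k : ℕ} {G : SimpleGraph V}
    {A : Fin k → Fin k → Prop} {r : V → Fin k} (hr : IsRoleColoring G A r) {x y : V}
    (h : G.Adj x y) : A (r x) (r y) := by
  have hy : r y ∈ r '' G.neighborSet x := ⟨y, h, rfl⟩
  rwa [hr x] at hy

theorem IsRoleColoring.exists_adj_of_rel {V : Type*} {k : ℕ} {G : SimpleGraph V}
    {A : Fin k → Fin k → Prop} {r : V → Fin k} (hr : IsRoleColoring G A r) {x : V} {j : Fin k}
    (h : A (r x) j) : ∃ y, G.Adj x y ∧ r y = j := by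
  have hj : j ∈ r '' G.neighborSet x := by rw [hr x]; exact h
  exact hj

theorem cycleAdj_iff_cast {k : ℕ} (i j : Fin k) :
    cycleAdj k i j ↔
      ((i.val : ZMod k) = j.val + 1 ∨ (j.val : ZMod k) = i.val + 1) := by
  have key (a b : Fin k) : (a.val + 1) % k = b.val ↔ (b.val : ZMod k) = a.val + 1 := by
    have hb := Nat.mod_eq_of_lt b.isLt
    rw [← Nat.cast_succ, ZMod.natCast_eq_natCast_iff', hb, eq_comm]
  rw [cycleAdj, key, key]

theorem exists_fin_cast_eq {k : ℕ} (hk : 0 < k) (c : ZMod k) :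
    ∃ j : Fin k, (j.val : ZMod k) = c := by
  have : NeZero k := ⟨hk.ne'⟩
  exact ⟨⟨c.val, ZMod.val_lt c⟩, ZMod.natCast_zmod_val c⟩

/-- A vertex whose only neighbours are `y` and `z` has their colours on opposite sides of its own
in a `C_k`-role colouring. -/
theorem IsRoleColoring.cast_add_cast_of_neighbors {V : Type*} {k : ℕ} (hk : 3 ≤ k)
    {G : SimpleGraph V} {r : V → Fin k} (hr : IsRoleColoring G (cycleAdj k) r) {x y z : V}
    (h : ∀ w, G.Adj x w → w = y ∨ w = z) :
    ((r y).val : ZMod k) + (r z).val = 2 * (r x).val := by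
  have two_ne : (2 : ZMod k) ≠ 0 := by
    intro h2
    have : ((2 : ℕ) : ZMod k) = 0 := by exact_mod_cast h2
    rw [ZMod.natCast_eq_zero_iff] at this
    exact absurd (Nat.le_of_dvd (by norm_num) this) (by omega)
  obtain ⟨j, hj⟩ := exists_fin_cast_eq (by omega : 0 < k) ((r x).val + 1)
  obtain ⟨l, hl⟩ := exists_fin_cast_eq (by omega : 0 < k) ((r x).val - 1)
  obtain ⟨p, hp, rfl⟩ := hr.exists_adj_of_rel ((cycleAdj_iff_cast (r x) j).2 (.inr hj))
  obtain ⟨q, hq, rfl⟩ := hr.exists_adj_of_rel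
    ((cycleAdj_iff_cast (r x) l).2 (.inl (by rw [hl]; ring)))
  rcases h p hp with rfl | rfl <;> rcases h q hq with rfl | rfl
  · exact absurd (by linear_combination hl - hj) two_ne
  · rw [hj, hl]; ring
  · rw [hj, hl]; ring
  · exact absurd (by linear_combination hl - hj) two_ne

theorem SimpleGraph.eq_or_eq_of_degree_eq_two_s9 {V : Type*} (G : SimpleGraph V) {x y z w : V}
    [Fintype (G.neighborSet x)] (hx : G.degree x = 2) (hy : G.Adj x y) (hz : G.Adj x z)
    (hyz : y ≠ z) (hw : G.Adj x w) : w = y ∨ w = z := by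
  classical
  have hsub : ({y, z} : Finset V) ⊆ G.neighborFinset x := by
    intro u hu
    rcases Finset.mem_insert.1 hu with rfl | hu
    · simpa using hy
    · rw [Finset.mem_singleton.1 hu]; simpa using hz
  have heq := Finset.eq_of_subset_of_card_le hsub (by
    rw [G.card_neighborFinset_eq_degree, hx, Finset.card_pair hyz])
  have : w ∈ ({y, z} : Finset V) := by rw [heq]; simpa using hw
  simpa using this

/-- A `P_k`-role colouring alternates in parity along edges, so `G` has no closed walk of odd
length. -/
theorem IsRoleColoring.even_of_closed {V : Type*} {k : ℕ} {G : SimpleGraph V} {r : V → Fin k}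
    (hr : IsRoleColoring G (pathAdj k) r) {n : ℕ} {w : ℕ → V} (hw : w n = w 0)
    (hadj : ∀ i < n, G.Adj (w i) (w (i + 1))) : Even n := by
  have hpar (i : ℕ) (hi : i ≤ n) : (r (w i)).val % 2 = ((r (w 0)).val + i) % 2 := by
    induction i with
    | zero => rfl
    | succ i ih =>
      have h := hr.rel_of_adj (hadj i (by omega))
      have := ih (by omega)
      unfold pathAdj at h
      omega
  have := hpar n le_rfl
  rw [hw] at this
  rw [Nat.even_iff]
  omega

/-- Colours progress arithmetically along a closed walk whose inner vertices have no neighbours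
outside the walk, so its length times a unit step vanishes modulo `k`. -/
theorem IsRoleColoring.dvd_of_closed {V : Type*} {k : ℕ} (hk : 3 ≤ k) {G : SimpleGraph V}
    {r : V → Fin k} (hr : IsRoleColoring G (cycleAdj k) r) {n : ℕ} {w : ℕ → V}
    (hw : w n = w 0) (hadj : G.Adj (w 0) (w 1))
    (hnbr : ∀ i, i + 1 < n → ∀ u, G.Adj (w (i + 1)) u → u = w i ∨ u = w (i + 2)) :
    k ∣ n := by
  let f (i : ℕ) : ZMod k := (r (w i)).val
  have hstep (i : ℕ) (hi : i + 1 < n) : f i + f (i + 2) = 2 * f (i + 1) :=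
    hr.cast_add_cast_of_neighbors hk (hnbr i hi)
  have hdiff (i : ℕ) (hi : i < n) : f (i + 1) - f i = f 1 - f 0 := by
    induction i with
    | zero => rfl
    | succ i ih => linear_combination ih (by omega) + hstep i hi
  have hprog (i : ℕ) (hi : i ≤ n) : f i = f 0 + i * (f 1 - f 0) := by
    induction i with
    | zero => simp
    | succ i ih =>
      push_cast
      linear_combination ih (by omega) + hdiff i (by omega)
  have hfn : f n = f 0 := by simp only [f, hw]
  have hzero := hprog n le_rfl
  rw [← ZMod.natCast_eq_zero_iff]
  have hone : f 0 = f 1 + 1 ∨ f 1 = f 0 + 1 := (cycleAdj_iff_cast _ _).1 (hr.rel_of_adj hadj)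
  rcases hone with h | h
  · linear_combination hzero - hfn - n * h
  · linear_combination hfn - hzero - n * h

/-- A graph containing a dangling induced cycle of length `2k-1` admits no
`P_k`-role colouring, and (for `k ≥ 3`) no `C_k`-role colouring. -/
theorem dangling_odd_cycle_no_path_or_cycle_coloring {V : Type*} [Fintype V]
    (G : SimpleGraph V) [DecidableRel G.Adj]
    (k : ℕ) (hk : 2 ≤ k)
    (v : ℕ → V)
    (hinj : ∀ i j : ℕ, i < 2 * k - 1 → j < 2 * k - 1 → v i = v j → i = j)
    (hcyc : ∀ i j : ℕ, i < 2 * k - 1 → j < 2 * k - 1 →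
      (G.Adj (v i) (v j) ↔ ((i + 1) % (2 * k - 1) = j ∨ (j + 1) % (2 * k - 1) = i)))
    (hdeg : ∀ i : ℕ, 1 ≤ i → i < 2 * k - 1 → G.degree (v i) = 2)
    (hdeg0 : G.degree (v 0) = 3) :
    (¬ ∃ r : V → Fin k, IsRoleColoring G (pathAdj k) r) ∧
    (3 ≤ k → ¬ ∃ r : V → Fin k, IsRoleColoring G (cycleAdj k) r) := by
  let n := 2 * k - 1
  let w (i : ℕ) : V := v (i % n)
  have hn : 3 ≤ n := by omega
  have hw : w n = w 0 := by simp [w]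
  have hw_lt (i : ℕ) (hi : i < n) : w i = v i := by simp only [w, Nat.mod_eq_of_lt hi]
  have hadj (i : ℕ) : G.Adj (w i) (w (i + 1)) :=
    (hcyc _ _ (Nat.mod_lt _ (by omega)) (Nat.mod_lt _ (by omega))).2
      (.inl (Nat.mod_add_mod i n 1))
  refine ⟨?_, ?_⟩
  · rintro ⟨r, hr⟩
    obtain ⟨m, hm⟩ := hr.even_of_closed hw fun i _ => hadj i
    omega
  · rintro hk3 ⟨r, hr⟩
    have hdvd : k ∣ n := by
      refine hr.dvd_of_closed hk3 hw (hadj 0) fun i hi u hu => ?_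
      refine G.eq_or_eq_of_degree_eq_two_s9 ?_ (hadj i).symm (hadj (i + 1)) ?_ hu
      · rw [hw_lt _ hi]
        exact hdeg _ (by omega) hi
      · intro h
        have heq : i % n = (i + 2) % n :=
          hinj _ _ (Nat.mod_lt _ (by omega)) (Nat.mod_lt _ (by omega)) h
        rw [Nat.mod_eq_of_lt (by omega)] at heq
        rcases Nat.lt_or_ge (i + 2) n with hlt | hge
        · rw [Nat.mod_eq_of_lt hlt] at heq
          omega
        · rw [show i + 2 = n by omega, Nat.mod_self] at heq
          omega
    obtain ⟨m, hm⟩ := hdvd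
    have hm' : 2 * k = k * m + 1 := by omega
    have hone : k ∣ 1 := (Nat.dvd_add_right (dvd_mul_right k m)).1 (hm' ▸ dvd_mul_left k 2)
    exact absurd (Nat.le_of_dvd one_pos hone) (by omega)
end

section
/- Let k ≥ 2 and let G be a simple graph on a finite vertex set containing two dangling induced cycles of length 2k whose attachment vertices are adjacent. Precisely, suppose there are pairwise distinct vertices v_1, …, v_{2k}, v'_1, …, v'_{2k}, u, u' such that: v_1, …, v_{2k} induce a cycle (v_i adjacent to v_{i+1} for 1 ≤ i ≤ 2k−1, v_{2k} adjacent to v_1, and no other adjacencies among them), and likewise v'_1, …, v'_{2k} induce a cycle; deg_G(v_i) = 2 and deg_G(v'_i) = 2 for every 2 ≤ i ≤ 2k; deg_G(v_1) = deg_G(v'_1) = 3; u is the unique neighbour of v_1 outside {v_1, …, v_{2k}} and u' is the unique neighbour of v'_1 outside {v'_1, …, v'_{2k}}; and u is adjacent to u'. Then G admits no P_k^*-role colouring. -/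
/-- Adjacency relation of the role graph `P_k^*`: the path on `Fin k`
with a loop at the end `k - 1`. -/
def pathStarAdj (k : ℕ) (i j : Fin k) : Prop :=
  (i.val + 1 = j.val ∨ j.val + 1 = i.val) ∨ (i = j ∧ i.val = k - 1)

/-- A closed sequence `a 0, …, a (2k) = a 0` of roles of `P_k^*` which is locally surjective at
all interior indices starts and ends its period at the looped role `k - 1`. -/
theorem pathStar_closed_sequence {k : ℕ} (hk : 2 ≤ k) (a : ℕ → ℕ)
    (hlt : ∀ i, a i < k) (hclosed : a (2 * k) = a 0)
    (hloc : ∀ i, i + 2 ≤ 2 * k → ∀ j < k, (j = a i ∨ j = a (i + 2)) ↔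
      ((a (i + 1) + 1 = j ∨ j + 1 = a (i + 1)) ∨ (a (i + 1) = j ∧ a (i + 1) = k - 1))) :
    a 0 = k - 1 ∧ a 1 = k - 1 ∧ a (2 * k - 1) = k - 1 := by
  have hnext : ∀ i, i + 2 ≤ 2 * k → a (i + 2) =
      if a i + 1 = a (i + 1) then (if a (i + 1) = k - 1 then k - 1 else a (i + 1) + 1)
      else if a (i + 1) = 0 then 1 else a (i + 1) - 1 := by
    intro i hi
    have l := hloc i hi
    have hlt1 := hlt (i + 1)
    have lp := (l _ (hlt i)).1 (Or.inl rfl)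
    have lx := (l _ (hlt (i + 2))).1 (Or.inr rfl)
    split_ifs with hp hc hc
    · have := (l _ hlt1).2 (by omega)
      omega
    · have := (l (a (i + 1) + 1) (by omega)).2 (by omega)
      omega
    · omega
    · have := (l (a (i + 1) - 1) (by omega)).2 (by omega)
      omega
  obtain ⟨F, hF⟩ : ∃ F : ℕ → ℕ, ∀ t, F t = if t < k then t else if t < 2 * k - 1 then 2 * k - 1 - t
      else if t < 3 * k - 1 then t - (2 * k - 1) else 4 * k - 2 - t := ⟨_, fun _ => rfl⟩
  obtain ⟨s, hs, h0, h1⟩ : ∃ s, s < 2 * k - 1 ∧ a 0 = F s ∧ a 1 = F (s + 1) := by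
    have hadj := (hloc 0 (by omega) (a 0) (hlt 0)).1 (Or.inl rfl)
    have hlt0 := hlt 0
    have hlt1 := hlt 1
    simp only [hF]
    rcases hadj with (h | h) | h
    · refine ⟨2 * k - 1 - a 0, ?_, ?_, ?_⟩ <;> grind
    · refine ⟨a 0, ?_, ?_, ?_⟩ <;> grind
    · refine ⟨k - 1, ?_, ?_, ?_⟩ <;> grind
  have key : ∀ i, i + 1 ≤ 2 * k → a i = F (s + i) ∧ a (i + 1) = F (s + i + 1) := by
    intro i
    induction i with
    | zero => exact fun _ => ⟨h0, h1⟩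
    | succ i ih =>
      intro hi
      obtain ⟨e0, e1⟩ := ih (by omega)
      refine ⟨e1, ?_⟩
      have h2 := hnext i (by omega)
      rw [hF] at e0 e1
      rw [hF, show i + 1 + 1 = i + 2 from rfl]
      split_ifs at e0 <;> split_ifs at e1 <;>
        first | omega | (split_ifs at h2 <;> first | omega | (split_ifs <;> omega))
  have hlast := (key (2 * k - 1) (by omega))
  rw [show 2 * k - 1 + 1 = 2 * k by omega, hclosed] at hlast
  obtain ⟨e, e'⟩ := hlast
  obtain rfl : s = k - 1 := by
    rw [hF] at h0 e'
    split_ifs at h0 <;> split_ifs at e' <;> omega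
  rw [hF] at h0 h1 e
  refine ⟨?_, ?_, ?_⟩
  · split_ifs at h0 <;> omega
  · split_ifs at h1 <;> omega
  · split_ifs at e <;> omega

/-- In a `P_k^*`-role colouring, the attachment vertex of a dangling induced cycle of length `2k`
has role `k - 2`. -/
theorem IsRoleColoring.dangling_cycle_attachment {V : Type*} [Fintype V]
    {G : SimpleGraph V} [DecidableRel G.Adj] {k : ℕ} (hk : 2 ≤ k) {v : ℕ → V} {u : V}
    (hinjv : ∀ i j : ℕ, i < 2 * k → j < 2 * k → v i = v j → i = j)
    (hcyc : ∀ i j : ℕ, i < 2 * k → j < 2 * k →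
      (G.Adj (v i) (v j) ↔ ((i + 1) % (2 * k) = j ∨ (j + 1) % (2 * k) = i)))
    (hdeg : ∀ i : ℕ, 1 ≤ i → i < 2 * k → G.degree (v i) = 2)
    (hhook : ∀ w : V, G.Adj (v 0) w → (∀ i : ℕ, i < 2 * k → w ≠ v i) → w = u)
    {r : V → Fin k} (hr : IsRoleColoring G (pathStarAdj k) r) :
    (r u).val = k - 2 := by
  classical
  have hnbr : ∀ i, i + 2 ≤ 2 * k →
      G.neighborFinset (v (i + 1)) = {v i, v ((i + 2) % (2 * k))} := by
    intro i hi
    have hm : (i + 2) % (2 * k) < 2 * k := Nat.mod_lt _ (by omega)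
    have hne : i ≠ (i + 2) % (2 * k) := by
      rcases hi.lt_or_eq with h | h
      · rw [Nat.mod_eq_of_lt h]; omega
      · rw [h, Nat.mod_self]; omega
    symm
    apply Finset.eq_of_subset_of_card_le
    · intro w hw
      rw [SimpleGraph.mem_neighborFinset]
      simp only [Finset.mem_insert, Finset.mem_singleton] at hw
      rcases hw with rfl | rfl
      · exact (hcyc _ _ (by omega) (by omega)).2 (Or.inr (Nat.mod_eq_of_lt (by omega)))
      · exact (hcyc _ _ (by omega) hm).2 (Or.inl rfl)
    · rw [SimpleGraph.card_neighborFinset_eq_degree, hdeg _ (by omega) (by omega),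
        Finset.card_pair fun h => hne (hinjv _ _ (by omega) hm h)]
  have hrole : ∀ x (j : Fin k), (∃ w, G.Adj x w ∧ r w = j) ↔ pathStarAdj k (r x) j :=
    fun x j => Set.ext_iff.1 (hr x) j
  obtain ⟨h0, h1, hl⟩ := pathStar_closed_sequence hk (fun i => (r (v (i % (2 * k)))).val)
    (fun i => (r _).isLt) (by simp) (by
      intro i hi j hj
      have h := hrole (v (i + 1)) ⟨j, hj⟩
      have hadj : ∀ w, G.Adj (v (i + 1)) w ↔ w = v i ∨ w = v ((i + 2) % (2 * k)) := by
        intro w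
        rw [← SimpleGraph.mem_neighborFinset, hnbr i hi]
        simp
      simp only [hadj, or_and_right, exists_or, exists_eq_left, pathStarAdj, Fin.ext_iff] at h
      simp only [Nat.mod_eq_of_lt (show i < 2 * k by omega),
        Nat.mod_eq_of_lt (show i + 1 < 2 * k by omega)]
      rw [← h, eq_comm, eq_comm (a := j)])
  simp only [Nat.zero_mod, Nat.mod_eq_of_lt (show 1 < 2 * k by omega),
    Nat.mod_eq_of_lt (show 2 * k - 1 < 2 * k by omega)] at h0 h1 hl
  obtain ⟨w, hw, hrw⟩ := (hrole (v 0) ⟨k - 2, by omega⟩).2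
    (Or.inl (Or.inr (by rw [h0]; change k - 2 + 1 = k - 1; omega)))
  have hwu : w = u := by
    refine hhook w hw fun i hi hwi => ?_
    subst hwi
    have hrw' : (r (v i)).val = k - 2 := congrArg Fin.val hrw
    rcases (hcyc 0 i (by omega) hi).1 hw with h | h
    · rw [Nat.mod_eq_of_lt (by omega)] at h
      subst h
      simp only [Nat.zero_add] at hrw'
      omega
    · have : i = 2 * k - 1 := by
        by_contra hne
        rw [Nat.mod_eq_of_lt (by omega)] at h
        omega
      subst this
      omega
  rw [← hwu, hrw]

/-- A graph containing two dangling induced cycles of length `2k` whose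
attachment vertices are adjacent admits no `P_k^*`-role colouring. -/
theorem two_dangling_cycles_no_pathStar_coloring {V : Type*} [Fintype V]
    (G : SimpleGraph V) [DecidableRel G.Adj]
    (k : ℕ) (hk : 2 ≤ k)
    (v v' : ℕ → V) (u u' : V)
    -- the vertices v 0, …, v (2k-1), v' 0, …, v' (2k-1), u, u' are pairwise distinct
    (hinjv : ∀ i j : ℕ, i < 2 * k → j < 2 * k → v i = v j → i = j)
    (hinjv' : ∀ i j : ℕ, i < 2 * k → j < 2 * k → v' i = v' j → i = j)
    (hdisj : ∀ i j : ℕ, i < 2 * k → j < 2 * k → v i ≠ v' j)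
    (hu : ∀ i : ℕ, i < 2 * k → u ≠ v i ∧ u ≠ v' i ∧ u' ≠ v i ∧ u' ≠ v' i)
    (huu' : u ≠ u')
    -- v 0, …, v (2k-1) induce a cycle, and likewise v' 0, …, v' (2k-1)
    (hcyc : ∀ i j : ℕ, i < 2 * k → j < 2 * k →
      (G.Adj (v i) (v j) ↔ ((i + 1) % (2 * k) = j ∨ (j + 1) % (2 * k) = i)))
    (hcyc' : ∀ i j : ℕ, i < 2 * k → j < 2 * k →
      (G.Adj (v' i) (v' j) ↔ ((i + 1) % (2 * k) = j ∨ (j + 1) % (2 * k) = i)))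
    -- degrees on the cycles
    (hdeg : ∀ i : ℕ, 1 ≤ i → i < 2 * k → G.degree (v i) = 2)
    (hdeg' : ∀ i : ℕ, 1 ≤ i → i < 2 * k → G.degree (v' i) = 2)
    (hdeg0 : G.degree (v 0) = 3)
    (hdeg0' : G.degree (v' 0) = 3)
    -- u is the unique neighbour of v 0 outside the first cycle,
    -- u' is the unique neighbour of v' 0 outside the second cycle
    (hhook : G.Adj (v 0) u ∧
      ∀ w : V, G.Adj (v 0) w → (∀ i : ℕ, i < 2 * k → w ≠ v i) → w = u)
    (hhook' : G.Adj (v' 0) u' ∧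
      ∀ w : V, G.Adj (v' 0) w → (∀ i : ℕ, i < 2 * k → w ≠ v' i) → w = u')
    -- the attachment vertices are adjacent
    (hadjuu' : G.Adj u u') :
    ¬ ∃ r : V → Fin k, IsRoleColoring G (pathStarAdj k) r := by
  rintro ⟨r, hr⟩
  have h := hr.dangling_cycle_attachment hk hinjv hcyc hdeg hhook.2
  have h' := hr.dangling_cycle_attachment hk hinjv' hcyc' hdeg' hhook'.2
  have hmem : r u' ∈ {j : Fin k | pathStarAdj k (r u) j} := hr u ▸ ⟨u', hadjuu', rfl⟩
  simp only [pathStarAdj, Set.mem_ofPred_eq] at hmem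
  omega
end

section
/- Let k ≥ 2, let G be a simple graph on a finite vertex set V, and let u, v be adjacent vertices of G with u ≠ v. Let G' be the graph obtained from G by subdividing the edge uv exactly 2k times: the vertex set of G' is V ⊕ Fin 2k with new vertices s_0, …, s_{2k−1}; two vertices of V are adjacent in G' iff they are adjacent in G and are not the pair {u, v}; u is adjacent to s_0, s_i is adjacent to s_{i+1} for 0 ≤ i ≤ 2k−2, and s_{2k−1} is adjacent to v; there are no other edges. Then G admits a P_k^{**}-role colouring if and only if G' admits a P_k^{**}-role colouring. -/
/-- The folding map of the cycle of length `2 * k` onto `P_k^{**}`, extended periodically to `ℕ`: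
`0, 1, …, k - 1, k - 1, …, 1, 0, 0, 1, …`. -/
def cycleFold (k : ℕ) (hk : 2 ≤ k) (n : ℕ) : Fin k :=
  ⟨min (n % (2 * k)) (2 * k - 1 - n % (2 * k)), by omega⟩

lemma succ_mod_eq_ite {m : ℕ} (hm : 2 ≤ m) (n : ℕ) :
    (n + 1) % m = if n % m + 1 = m then 0 else n % m + 1 := by
  have h := Nat.mod_lt n (show 0 < m by omega)
  rw [Nat.add_mod, Nat.mod_eq_of_lt (show 1 < m by omega)]
  split_ifs with h'
  · rw [h', Nat.mod_self]
  · exact Nat.mod_eq_of_lt (by omega)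

lemma cycleFold_add_period (k : ℕ) (hk : 2 ≤ k) (n : ℕ) :
    cycleFold k hk (n + 2 * k) = cycleFold k hk n := by
  simp [cycleFold]

lemma cycleFold_ne_add_two (k : ℕ) (hk : 2 ≤ k) (n : ℕ) :
    cycleFold k hk n ≠ cycleFold k hk (n + 2) := by
  have h1 := succ_mod_eq_ite (show 2 ≤ 2 * k by omega) n
  have h2 := succ_mod_eq_ite (show 2 ≤ 2 * k by omega) (n + 1)
  have h := Nat.mod_lt n (show 0 < 2 * k by omega)
  simp only [cycleFold, ne_eq, Fin.mk.injEq]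
  rw [show n + 2 = n + 1 + 1 from rfl]
  generalize n % (2 * k) = a at *
  generalize (n + 1) % (2 * k) = b at *
  generalize (n + 1 + 1) % (2 * k) = c at *
  split_ifs at h1 h2 <;> omega

lemma setOf_pathStarStarAdj_cycleFold (k : ℕ) (hk : 2 ≤ k) (n : ℕ) :
    {j : Fin k | pathStarStarAdj k (cycleFold k hk (n + 1)) j} =
      {cycleFold k hk n, cycleFold k hk (n + 2)} := by
  have h1 := succ_mod_eq_ite (show 2 ≤ 2 * k by omega) n
  have h2 := succ_mod_eq_ite (show 2 ≤ 2 * k by omega) (n + 1)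
  have h := Nat.mod_lt n (show 0 < 2 * k by omega)
  ext ⟨j, hj⟩
  simp only [pathStarStarAdj, cycleFold, Set.mem_ofPred_eq, Set.mem_insert_iff,
    Set.mem_singleton_iff, Fin.mk.injEq]
  rw [show n + 2 = n + 1 + 1 from rfl]
  generalize n % (2 * k) = a at *
  generalize (n + 1) % (2 * k) = b at *
  generalize (n + 1 + 1) % (2 * k) = c at *
  split_ifs at h1 h2 <;> omega

lemma exists_cycleFold_of_pathStarStarAdj (k : ℕ) (hk : 2 ≤ k) (a b : Fin k)
    (h : pathStarStarAdj k a b) :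
    ∃ x, cycleFold k hk x = a ∧ cycleFold k hk (x + 1) = b := by
  have ha : cycleFold k hk (a.val + 2 * k) = a := by
    ext
    simp only [cycleFold, Nat.add_mod_right, Nat.mod_eq_of_lt (show a.val < 2 * k by omega)]
    omega
  have ha' : cycleFold k hk (2 * k - 1 - a.val) = a := by
    ext
    simp only [cycleFold, Nat.mod_eq_of_lt (show 2 * k - 1 - a.val < 2 * k by omega)]
    omega
  have hb : cycleFold k hk b.val = b := by
    ext
    simp only [cycleFold, Nat.mod_eq_of_lt (show b.val < 2 * k by omega)]
    omega
  have hb' : cycleFold k hk (2 * k - 1 - b.val) = b := by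
    ext
    simp only [cycleFold, Nat.mod_eq_of_lt (show 2 * k - 1 - b.val < 2 * k by omega)]
    omega
  rcases h with (h | h) | ⟨h, h0 | h0⟩
  · refine ⟨a.val + 2 * k, ha, ?_⟩
    rw [show a.val + 2 * k + 1 = b.val + 2 * k by omega, cycleFold_add_period, hb]
  · refine ⟨2 * k - 1 - a.val, ha', ?_⟩
    rw [show 2 * k - 1 - a.val + 1 = 2 * k - 1 - b.val by omega, hb']
  · subst h
    refine ⟨2 * k - 1 - a.val, ha', ?_⟩
    rw [show 2 * k - 1 - a.val + 1 = a.val + 2 * k by omega, ha]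
  · subst h
    refine ⟨a.val + 2 * k, ha, ?_⟩
    rw [show a.val + 2 * k + 1 = 2 * k - 1 - a.val + 2 * k by omega, cycleFold_add_period, ha']

/-- The path `u, s_0, …, s_{m-1}, v` replacing the edge `uv` when it is subdivided `m` times. -/
def subdividedPath {V : Type*} (m : ℕ) (u v : V) : ℕ → V ⊕ Fin m
  | 0 => Sum.inl u
  | i + 1 => if h : i < m then Sum.inr ⟨i, h⟩ else Sum.inl v

lemma subdividedPath_succ {V : Type*} {m : ℕ} (u v : V) (i : Fin m) :
    subdividedPath m u v (i.val + 1) = Sum.inr i := by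
  simp [subdividedPath]

lemma subdividedPath_last {V : Type*} (m : ℕ) (u v : V) :
    subdividedPath m u v (m + 1) = Sum.inl v := by
  simp [subdividedPath]

section Subdivision

variable {V : Type*} {m : ℕ} {G : SimpleGraph V} {u v : V} {G' : SimpleGraph (V ⊕ Fin m)}

lemma neighborSet_inr_of_subdivision
    (h2 : ∀ (a : V) (i : Fin m), G'.Adj (Sum.inl a) (Sum.inr i) ↔
      ((a = u ∧ i.val = 0) ∨ (a = v ∧ i.val = m - 1)))
    (h3 : ∀ i j : Fin m, G'.Adj (Sum.inr i) (Sum.inr j) ↔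
      (i.val + 1 = j.val ∨ j.val + 1 = i.val)) (i : Fin m) :
    G'.neighborSet (Sum.inr i) =
      {subdividedPath m u v i.val, subdividedPath m u v (i.val + 2)} := by
  obtain ⟨i, hi⟩ := i
  ext (a | ⟨j, hj⟩)
  · rw [SimpleGraph.mem_neighborSet, SimpleGraph.adj_comm, h2]
    rcases i with _ | i <;> simp only [subdividedPath, Set.mem_insert_iff, Set.mem_singleton_iff]
      <;> split_ifs <;> simp <;> grind
  · rw [SimpleGraph.mem_neighborSet, h3]
    rcases i with _ | i <;> simp only [subdividedPath, Set.mem_insert_iff, Set.mem_singleton_iff]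
      <;> split_ifs <;> simp <;> omega

lemma image_neighborSet_inl_of_subdivision {α : Type*} (hm : 0 < m) (huv : G.Adj u v)
    (h1 : ∀ a b : V, G'.Adj (Sum.inl a) (Sum.inl b) ↔
      (G.Adj a b ∧ ¬(a = u ∧ b = v) ∧ ¬(a = v ∧ b = u)))
    (h2 : ∀ (a : V) (i : Fin m), G'.Adj (Sum.inl a) (Sum.inr i) ↔
      ((a = u ∧ i.val = 0) ∨ (a = v ∧ i.val = m - 1)))
    (r : V ⊕ Fin m → α)
    (hu : r (subdividedPath m u v m) = r (Sum.inl u))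
    (hv : r (subdividedPath m u v 1) = r (Sum.inl v)) (a : V) :
    r '' G'.neighborSet (Sum.inl a) = (r ∘ Sum.inl) '' G.neighborSet a := by
  have hu' : r (Sum.inr ⟨m - 1, by omega⟩) = r (Sum.inl u) := by
    rw [← hu, ← subdividedPath_succ u v]
    congr 2
    simp only
    omega
  have hv' : r (Sum.inr ⟨0, hm⟩) = r (Sum.inl v) := by
    rw [← hv, ← subdividedPath_succ u v]
  apply Set.Subset.antisymm
  · rintro _ ⟨b | i, hb, rfl⟩
    · exact ⟨b, ((h1 a b).1 hb).1, rfl⟩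
    · rcases (h2 a i).1 hb with ⟨rfl, hi⟩ | ⟨rfl, hi⟩
      · obtain rfl : i = ⟨0, hm⟩ := Fin.ext hi
        exact ⟨v, huv, hv'.symm⟩
      · have hi' : i = ⟨m - 1, by omega⟩ := Fin.ext hi
        exact ⟨u, huv.symm, by rw [hi', hu']; rfl⟩
  · rintro _ ⟨b, hb, rfl⟩
    by_cases hab : a = u ∧ b = v
    · exact ⟨_, (h2 a ⟨0, hm⟩).2 (Or.inl ⟨hab.1, rfl⟩), by simp [hv', hab.2]⟩
    by_cases hba : a = v ∧ b = u
    · exact ⟨_, (h2 a ⟨m - 1, by omega⟩).2 (Or.inr ⟨hba.1, rfl⟩), by simp [hu', hba.2]⟩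
    exact ⟨Sum.inl b, (h1 a b).2 ⟨hb, hab, hba⟩, rfl⟩

end Subdivision

/-- A role colouring is determined on the subdivided edge by its first two colours. -/
lemma IsRoleColoring.subdividedPath_eq_cycleFold {V : Type*} {m k : ℕ} (hk : 2 ≤ k) {u v : V}
    {G' : SimpleGraph (V ⊕ Fin m)}
    (hN : ∀ i : Fin m, G'.neighborSet (Sum.inr i) =
      {subdividedPath m u v i.val, subdividedPath m u v (i.val + 2)})
    {r : V ⊕ Fin m → Fin k} (hr : IsRoleColoring G' (pathStarStarAdj k) r) {x : ℕ}
    (h0 : r (subdividedPath m u v 0) = cycleFold k hk x)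
    (h1 : r (subdividedPath m u v 1) = cycleFold k hk (x + 1)) (i : ℕ) (hi : i ≤ m) :
    r (subdividedPath m u v i) = cycleFold k hk (x + i) ∧
      r (subdividedPath m u v (i + 1)) = cycleFold k hk (x + i + 1) := by
  induction i with
  | zero => exact ⟨h0, h1⟩
  | succ i ih =>
    obtain ⟨ha, hb⟩ := ih (by omega)
    refine ⟨hb, ?_⟩
    have h := hr (Sum.inr ⟨i, hi⟩)
    rw [hN, ← subdividedPath_succ u v, hb, setOf_pathStarStarAdj_cycleFold, Set.image_pair,
      ha] at h
    have hmem : cycleFold k hk (x + i + 2) ∈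
        ({cycleFold k hk (x + i), r (subdividedPath m u v (i + 2))} : Set (Fin k)) := by
      rw [h]
      simp
    rcases hmem with h' | h'
    · exact absurd h'.symm (cycleFold_ne_add_two k hk (x + i))
    · exact h'.symm

/-- Subdividing an edge `2k` times preserves `P_k^{**}`-role colourability. -/
theorem subdivision_preserves_pathStarStar_colorability {V : Type*} [Fintype V]
    (k : ℕ) (hk : 2 ≤ k)
    (G : SimpleGraph V) (u v : V) (huv : G.Adj u v)
    (G' : SimpleGraph (V ⊕ Fin (2 * k)))
    -- old vertices keep their adjacencies, except that the edge uv is removed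
    (h1 : ∀ a b : V, G'.Adj (Sum.inl a) (Sum.inl b) ↔
      (G.Adj a b ∧ ¬(a = u ∧ b = v) ∧ ¬(a = v ∧ b = u)))
    -- u is adjacent to s_0 and v is adjacent to s_{2k-1}, and these are the
    -- only edges between old and new vertices
    (h2 : ∀ (a : V) (i : Fin (2 * k)), G'.Adj (Sum.inl a) (Sum.inr i) ↔
      ((a = u ∧ i.val = 0) ∨ (a = v ∧ i.val = 2 * k - 1)))
    -- the new vertices s_0, …, s_{2k-1} form a path
    (h3 : ∀ i j : Fin (2 * k), G'.Adj (Sum.inr i) (Sum.inr j) ↔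
      (i.val + 1 = j.val ∨ j.val + 1 = i.val)) :
    (∃ r : V → Fin k, IsRoleColoring G (pathStarStarAdj k) r) ↔
    (∃ r' : V ⊕ Fin (2 * k) → Fin k, IsRoleColoring G' (pathStarStarAdj k) r') := by
  have hN := neighborSet_inr_of_subdivision h2 h3
  constructor
  · rintro ⟨r, hr⟩
    have hadj : pathStarStarAdj k (r u) (r v) := by
      have h : r v ∈ r '' G.neighborSet u := ⟨v, huv, rfl⟩
      rwa [hr u] at h
    obtain ⟨x, hxu, hxv⟩ := exists_cycleFold_of_pathStarStarAdj k hk _ _ hadj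
    let r' : V ⊕ Fin (2 * k) → Fin k := Sum.elim r fun i => cycleFold k hk (x + (i.val + 1))
    have hpath : ∀ i ≤ 2 * k + 1, r' (subdividedPath (2 * k) u v i) = cycleFold k hk (x + i) := by
      intro i hi
      rcases i with _ | i
      · exact hxu.symm
      · rcases Nat.lt_or_ge i (2 * k) with h | h
        · exact congrArg r' (subdividedPath_succ u v ⟨i, h⟩)
        · obtain rfl : i = 2 * k := by omega
          rw [subdividedPath_last, show x + (2 * k + 1) = x + 1 + 2 * k by omega,
            cycleFold_add_period, hxv]
          rfl
    refine ⟨r', ?_⟩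
    rintro (a | i)
    · rw [image_neighborSet_inl_of_subdivision (by omega) huv h1 h2]
      · exact hr a
      · rw [hpath _ (by omega), cycleFold_add_period, hxu]
        rfl
      · rw [hpath _ (by omega), hxv]
        rfl
    · rw [hN, Set.image_pair, hpath _ (by omega), hpath _ (by omega)]
      exact (setOf_pathStarStarAdj_cycleFold k hk (x + i.val)).symm
  · rintro ⟨r, hr⟩
    have hadj : pathStarStarAdj k (r (Sum.inl u)) (r (Sum.inr ⟨0, by omega⟩)) := by
      have h : r (Sum.inr ⟨0, by omega⟩) ∈ r '' G'.neighborSet (Sum.inl u) :=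
        ⟨_, (h2 u ⟨0, by omega⟩).2 (Or.inl ⟨rfl, rfl⟩), rfl⟩
      rwa [hr (Sum.inl u)] at h
    obtain ⟨x, hxu, hxv⟩ := exists_cycleFold_of_pathStarStarAdj k hk _ _ hadj
    have hs : r (subdividedPath (2 * k) u v 1) = cycleFold k hk (x + 1) := by
      rw [hxv, ← subdividedPath_succ u v]
    obtain ⟨hlast, hend⟩ := hr.subdividedPath_eq_cycleFold hk hN hxu.symm hs (2 * k) le_rfl
    rw [cycleFold_add_period, hxu] at hlast
    rw [subdividedPath_last, show x + 2 * k + 1 = x + 1 + 2 * k by omega,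
      cycleFold_add_period] at hend
    refine ⟨r ∘ Sum.inl, fun a => ?_⟩
    rw [← image_neighborSet_inl_of_subdivision (by omega) huv h1 h2 r hlast (hs.trans hend.symm)]
    exact hr (Sum.inl a)
end

section
/- Let k ≥ 3, let G be a simple graph on a finite vertex set V, and let u, v be adjacent vertices of G with u ≠ v. Let G' be the graph obtained from G by subdividing the edge uv exactly k times: the vertex set of G' is V ⊕ Fin k with new vertices s_0, …, s_{k−1}; two vertices of V are adjacent in G' iff they are adjacent in G and are not the pair {u, v}; u is adjacent to s_0, s_i is adjacent to s_{i+1} for 0 ≤ i ≤ k−2, and s_{k−1} is adjacent to v; there are no other edges. Then G admits a C_k-role colouring if and only if G' admits a C_k-role colouring. -/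
theorem cycleAdj_iff (n : ℕ) (i j : Fin (n + 3)) :
    cycleAdj (n + 3) i j ↔ j = i + 1 ∨ j = i - 1 := by
  rw [eq_sub_iff_add_eq, Fin.ext_iff, Fin.ext_iff, Fin.val_add, Fin.val_add, cycleAdj]
  simp only [Fin.val_one]
  tauto

/-- A `C_k`-role colouring, described by either of the two orientations `e = ±1` of the cycle. -/
theorem isRoleColoring_cycleAdj_iff {W : Type*} {n : ℕ} (H : SimpleGraph W) (r : W → Fin (n + 3))
    {e : Fin (n + 3)} (he : e = 1 ∨ e = -1) :
    IsRoleColoring H (cycleAdj (n + 3)) r ↔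
      ∀ x, (∀ y, H.Adj x y → r y = r x + e ∨ r y = r x - e) ∧
        (∃ y, H.Adj x y ∧ r y = r x + e) ∧ ∃ y, H.Adj x y ∧ r y = r x - e := by
  have key : ∀ i j : Fin (n + 3), cycleAdj (n + 3) i j ↔ j = i + e ∨ j = i - e := by
    intro i j
    rw [cycleAdj_iff]
    rcases he with rfl | rfl
    · rfl
    · rw [sub_neg_eq_add, ← sub_eq_add_neg, or_comm]
  refine forall_congr' fun x => ?_
  simp only [Set.ext_iff, Set.mem_image, SimpleGraph.mem_neighborSet, Set.mem_ofPred_eq, key]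
  constructor
  · intro h
    exact ⟨fun y hy => (h _).1 ⟨y, hy, rfl⟩, (h _).2 (Or.inl rfl), (h _).2 (Or.inr rfl)⟩
  · rintro ⟨h, hp, hm⟩ j
    constructor
    · rintro ⟨y, hy, rfl⟩
      exact h y hy
    · rintro (rfl | rfl)
      · exact hp
      · exact hm

theorem Fin.add_self_ne_zero_of_eq_one_or_neg_one {n : ℕ} {e : Fin (n + 3)}
    (he : e = 1 ∨ e = -1) : e + e ≠ 0 := by
  have h : (1 : Fin (n + 3)) + 1 ≠ 0 := by
    rw [Ne, Fin.ext_iff, Fin.val_add, Fin.val_one, Nat.mod_eq_of_lt (by omega)]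
    simp
  rcases he with rfl | rfl
  · exact h
  · rwa [← neg_add, neg_ne_zero]

theorem Fin.card_nsmul_eq_zero {n : ℕ} (e : Fin (n + 1)) : (n + 1) • e = 0 := by
  simpa using _root_.card_nsmul_eq_zero' (x := e)

/-- Subdividing an edge `k` times preserves `C_k`-role colourability. -/
theorem subdivision_preserves_cycle_colorability {V : Type*} [Fintype V]
    (k : ℕ) (hk : 3 ≤ k)
    (G : SimpleGraph V) (u v : V) (huv : G.Adj u v)
    (G' : SimpleGraph (V ⊕ Fin k))
    -- old vertices keep their adjacencies, except that the edge uv is removed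
    (h1 : ∀ a b : V, G'.Adj (Sum.inl a) (Sum.inl b) ↔
      (G.Adj a b ∧ ¬(a = u ∧ b = v) ∧ ¬(a = v ∧ b = u)))
    -- u is adjacent to s_0 and v is adjacent to s_{k-1}, and these are the
    -- only edges between old and new vertices
    (h2 : ∀ (a : V) (i : Fin k), G'.Adj (Sum.inl a) (Sum.inr i) ↔
      ((a = u ∧ i.val = 0) ∨ (a = v ∧ i.val = k - 1)))
    -- the new vertices s_0, …, s_{k-1} form a path
    (h3 : ∀ i j : Fin k, G'.Adj (Sum.inr i) (Sum.inr j) ↔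
      (i.val + 1 = j.val ∨ j.val + 1 = i.val)) :
    (∃ r : V → Fin k, IsRoleColoring G (cycleAdj k) r) ↔
    (∃ r' : V ⊕ Fin k → Fin k, IsRoleColoring G' (cycleAdj k) r') := by
  obtain ⟨n, rfl⟩ : ∃ n, k = n + 3 := ⟨k - 3, by omega⟩
  have hcard : ∀ e : Fin (n + 3), (n + 3) • e = 0 := fun e => Fin.card_nsmul_eq_zero e
  have hus : G'.Adj (Sum.inl u) (Sum.inr 0) := (h2 _ _).2 (Or.inl ⟨rfl, rfl⟩)
  have hvs : G'.Adj (Sum.inl v) (Sum.inr (Fin.last _)) := (h2 _ _).2 (Or.inr ⟨rfl, rfl⟩)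
  constructor
  · rintro ⟨r, hr⟩
    obtain ⟨e, he, hv⟩ : ∃ e, (e = 1 ∨ e = -1) ∧ r v = r u + e := by
      rcases (((isRoleColoring_cycleAdj_iff G r (Or.inl rfl)).1 hr) u).1 v huv with h | h
      · exact ⟨1, Or.inl rfl, h⟩
      · exact ⟨-1, Or.inr rfl, by rw [h, sub_eq_add_neg]⟩
    rw [isRoleColoring_cycleAdj_iff G r he] at hr
    let r' : V ⊕ Fin (n + 3) → Fin (n + 3) := Sum.elim r fun i => r u + (i.val + 1) • e
    have hl : ∀ a, r' (Sum.inl a) = r a := fun _ => rfl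
    have hs : ∀ i, r' (Sum.inr i) = r u + (i.val + 1) • e := fun _ => rfl
    have hs0 : r' (Sum.inr 0) = r v := by rw [hs, hv]; simp
    have hsl : r' (Sum.inr (Fin.last _)) = r u := by
      rw [hs, Fin.val_last, hcard, add_zero]
    have hlift : ∀ a y, G.Adj a y → ∃ y', G'.Adj (Sum.inl a) y' ∧ r' y' = r y := by
      intro a y hay
      by_cases hc : a = u ∧ y = v
      · obtain ⟨rfl, rfl⟩ := hc
        exact ⟨_, hus, hs0⟩
      by_cases hd : a = v ∧ y = u
      · obtain ⟨rfl, rfl⟩ := hd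
        exact ⟨_, hvs, hsl⟩
      exact ⟨Sum.inl y, (h1 _ _).2 ⟨hay, hc, hd⟩, rfl⟩
    have hstep : ∀ i j : Fin (n + 3), i.val + 1 = j.val →
        r' (Sum.inr j) = r' (Sum.inr i) + e := by
      intro i j hij
      rw [hs, hs, ← hij, succ_nsmul e (i.val + 1), add_assoc]
    have hend : ∀ (a : V) (i : Fin (n + 3)), G'.Adj (Sum.inl a) (Sum.inr i) →
        (a = u ∧ r' (Sum.inr i) = r a + e) ∨ (a = v ∧ r' (Sum.inr i) = r a - e) := by
      intro a i hai
      rcases (h2 a i).1 hai with ⟨rfl, hi⟩ | ⟨rfl, hi⟩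
      · obtain rfl : i = 0 := Fin.ext hi
        exact Or.inl ⟨rfl, by rw [hs0, hv]⟩
      · obtain rfl : i = Fin.last _ := Fin.ext hi
        exact Or.inr ⟨rfl, by rw [hsl, hv, add_sub_cancel_right]⟩
    refine ⟨r', (isRoleColoring_cycleAdj_iff G' r' he).2 ?_⟩
    rintro (a | i)
    · refine ⟨?_, ?_, ?_⟩
      · rintro (b | i) hab
        · exact (hr a).1 b ((h1 _ _).1 hab).1
        · exact (hend a i hab).imp And.right And.right
      · obtain ⟨y, hy, hye⟩ := (hr a).2.1
        obtain ⟨y', hy', h⟩ := hlift a y hy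
        exact ⟨y', hy', h.trans hye⟩
      · obtain ⟨y, hy, hye⟩ := (hr a).2.2
        obtain ⟨y', hy', h⟩ := hlift a y hy
        exact ⟨y', hy', h.trans hye⟩
    · refine ⟨?_, ?_, ?_⟩
      · rintro (b | j) hij
        · rcases hend b i hij.symm with ⟨-, h⟩ | ⟨-, h⟩
          · exact Or.inr (by rw [hl, h, add_sub_cancel_right])
          · exact Or.inl (by rw [hl, h, sub_add_cancel])
        · rcases (h3 i j).1 hij with h | h
          · exact Or.inl (hstep i j h)
          · exact Or.inr (by rw [hstep j i h, add_sub_cancel_right])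
      · by_cases hi : i.val + 1 < n + 3
        · exact ⟨Sum.inr ⟨i.val + 1, hi⟩, (h3 _ _).2 (Or.inl rfl), hstep _ _ rfl⟩
        · obtain rfl : i = Fin.last _ := Fin.ext (by rw [Fin.val_last]; omega)
          exact ⟨Sum.inl v, hvs.symm, by rw [hsl, hl, hv]⟩
      · by_cases hi : i.val = 0
        · obtain rfl : i = 0 := Fin.ext hi
          exact ⟨Sum.inl u, hus.symm, by rw [hs0, hl, hv, add_sub_cancel_right]⟩
        · have hj : i.val - 1 + 1 = i.val := by omega
          refine ⟨Sum.inr ⟨i.val - 1, by omega⟩, (h3 _ _).2 (Or.inr hj), ?_⟩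
          rw [hstep ⟨i.val - 1, by omega⟩ i hj, add_sub_cancel_right]
  · rintro ⟨r', hr⟩
    obtain ⟨e, he, hs0⟩ : ∃ e, (e = 1 ∨ e = -1) ∧ r' (Sum.inr 0) = r' (Sum.inl u) + e := by
      rcases (((isRoleColoring_cycleAdj_iff G' r' (Or.inl rfl)).1 hr) _).1 _ hus with h | h
      · exact ⟨1, Or.inl rfl, h⟩
      · exact ⟨-1, Or.inr rfl, by rw [h, sub_eq_add_neg]⟩
    have hee := Fin.add_self_ne_zero_of_eq_one_or_neg_one he
    rw [isRoleColoring_cycleAdj_iff G' r' he] at hr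
    have hne : ∀ c : Fin (n + 3), c ≠ c + e + e := by
      intro c h
      rw [add_assoc, left_eq_add] at h
      exact hee h
    have hstep : ∀ (m : ℕ) (hm : m + 1 < n + 3),
        r' (Sum.inr ⟨m + 1, hm⟩) = r' (Sum.inr ⟨m, by omega⟩) + e := by
      intro m
      induction m with
      | zero =>
        intro hm
        obtain ⟨y, hy, hye⟩ := (hr (Sum.inr 0)).2.1
        rcases y with a | j
        · rcases (h2 a 0).1 hy.symm with ⟨rfl, -⟩ | ⟨-, h⟩
          · rw [hs0] at hye
            exact absurd hye (hne _)
          · simp at h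
        · obtain rfl : j = ⟨0 + 1, hm⟩ := by
            rcases (h3 _ j).1 hy with h | h
            · exact Fin.ext h.symm
            · simp at h
          exact hye
      | succ m ih =>
        intro hm
        obtain ⟨y, hy, hye⟩ := (hr (Sum.inr ⟨m + 1, by omega⟩)).2.1
        rcases y with a | j
        · rcases (h2 a _).1 hy.symm with ⟨-, h⟩ | ⟨-, h⟩
          · simp at h
          · simp only at h
            omega
        · rcases (h3 _ j).1 hy with h | h
          · obtain rfl : j = ⟨m + 1 + 1, hm⟩ := Fin.ext h.symm
            exact hye
          · obtain rfl : j = ⟨m, Nat.lt_of_succ_lt (Nat.lt_of_succ_lt hm)⟩ :=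
              Fin.ext (by simpa using h)
            rw [ih (by omega)] at hye
            exact absurd hye (hne _)
    have hs : ∀ (m : ℕ) (hm : m < n + 3),
        r' (Sum.inr ⟨m, hm⟩) = r' (Sum.inl u) + (m + 1) • e := by
      intro m
      induction m with
      | zero => intro hm; simpa using hs0
      | succ m ih => intro hm; rw [hstep m hm, ih, succ_nsmul e (m + 1), add_assoc]
    have hsl : r' (Sum.inr (Fin.last _)) = r' (Sum.inl u) := by
      rw [Fin.last, hs, hcard, add_zero]
    have hv : r' (Sum.inl v) = r' (Sum.inl u) + e := by
      obtain ⟨y, hy, hye⟩ := (hr (Sum.inr (Fin.last _))).2.1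
      rw [hsl] at hye
      rcases y with a | j
      · rcases (h2 a _).1 hy.symm with ⟨-, h⟩ | ⟨rfl, -⟩
        · simp at h
        · exact hye
      · obtain rfl : j = ⟨n + 1, Nat.lt_succ_of_lt (Nat.lt_succ_self _)⟩ := by
          rcases (h3 _ j).1 hy with h | h
          · rw [Fin.val_last] at h
            omega
          · exact Fin.ext (by simpa using h)
        have h := hstep (n + 1) (by omega)
        rw [hye] at h
        exact absurd (hsl.symm.trans h) (hne _)
    have hlower : ∀ a y', G'.Adj (Sum.inl a) y' → ∃ y, G.Adj a y ∧ r' (Sum.inl y) = r' y' := by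
      rintro a (b | i) hay
      · exact ⟨b, ((h1 _ _).1 hay).1, rfl⟩
      · rcases (h2 a i).1 hay with ⟨rfl, hi⟩ | ⟨rfl, hi⟩
        · obtain rfl : i = 0 := Fin.ext hi
          exact ⟨v, huv, by rw [hv, hs0]⟩
        · obtain rfl : i = Fin.last _ := Fin.ext hi
          exact ⟨u, huv.symm, hsl.symm⟩
    refine ⟨fun a => r' (Sum.inl a), (isRoleColoring_cycleAdj_iff G _ he).2 fun a => ⟨?_, ?_, ?_⟩⟩
    · intro y hay
      by_cases hc : a = u ∧ y = v
      · obtain ⟨rfl, rfl⟩ := hc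
        exact Or.inl hv
      by_cases hd : a = v ∧ y = u
      · obtain ⟨rfl, rfl⟩ := hd
        exact Or.inr (by simp only [hv, add_sub_cancel_right])
      exact (hr (Sum.inl a)).1 (Sum.inl y) ((h1 _ _).2 ⟨hay, hc, hd⟩)
    · obtain ⟨y', hy', h'⟩ := (hr (Sum.inl a)).2.1
      obtain ⟨y, hy, h⟩ := hlower a y' hy'
      exact ⟨y, hy, h.trans h'⟩
    · obtain ⟨y', hy', h'⟩ := (hr (Sum.inl a)).2.2
      obtain ⟨y, hy, h⟩ := hlower a y' hy'
      exact ⟨y, hy, h.trans h'⟩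
end
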